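/- arXiv:2007.12457 — 2 statements merged into one kernel-verified Lean document; each statement's English description precedes it below -/
import Mathlib

section
/- Let U, Y, Z be real Banach spaces, let J : Y × U → ℝ be a cost functional and e : Y × U → Z* a state operator, both Fréchet differentiable at the point (S(u), u), and let S : U → Y be a solution map for the state equation satisfying e(S(u'), u') = 0 for all u' in a neighborhood of u and Fréchet differentiable at u. Define the reduced cost functional Ĵ(u) = J(S(u), u). Suppose p ∈ Z satisfies the adjoint equation: for all v ∈ Y, (e_y(S(u), u)[v])(p) = − J_y(S(u), u)[v]. Then the derivative of the reduced cost functional is given by the adjoint representation: for every h ∈ U, Ĵ'(u)[h] = J_u(S(u), u)[h] + (e_u(S(u), u)[h])(p). -/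
/-- If `J` and `e` are Fréchet differentiable at `(S u, u)`, the solution map `S` is Fréchet
differentiable at `u` and satisfies `e(S u', u') = 0` near `u`, and `p ∈ Z` solves the
adjoint equation `(e_y(S u, u)[v])(p) = - J_y(S u, u)[v]` for all `v ∈ Y`, then the
derivative of the reduced cost functional `Ĵ(u) = J(S u, u)` has the adjoint representation
`Ĵ'(u)[h] = J_u(S u, u)[h] + (e_u(S u, u)[h])(p)`. -/
theorem adjoint_representation_of_reduced_derivative
    {U Y Z : Type*}
    [NormedAddCommGroup U] [NormedSpace ℝ U] [CompleteSpace U]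
    [NormedAddCommGroup Y] [NormedSpace ℝ Y] [CompleteSpace Y]
    [NormedAddCommGroup Z] [NormedSpace ℝ Z] [CompleteSpace Z]
    (J : Y × U → ℝ) (e : Y × U → (Z →L[ℝ] ℝ))
    (S : U → Y) (u : U)
    (J' : Y × U →L[ℝ] ℝ) (hJ : HasFDerivAt J J' (S u, u))
    (e' : Y × U →L[ℝ] (Z →L[ℝ] ℝ)) (he : HasFDerivAt e e' (S u, u))
    (S' : U →L[ℝ] Y) (hS' : HasFDerivAt S S' u)
    (hstate : ∀ᶠ u' in nhds u, e (S u', u') = 0)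
    (p : Z) (hadj : ∀ v : Y, (e' (v, 0)) p = - J' (v, 0)) :
    ∃ D : U →L[ℝ] ℝ, HasFDerivAt (fun u' : U => J (S u', u')) D u ∧
      ∀ h : U, D h = J' (0, h) + (e' (0, h)) p := by
  have hg : HasFDerivAt (fun u' : U => (S u', u')) (S'.prod (ContinuousLinearMap.id ℝ U)) u :=
    hS'.prodMk (hasFDerivAt_id u)
  have hzero : e' ∘L S'.prod (ContinuousLinearMap.id ℝ U) = 0 :=
    (HasFDerivAt.comp (f := fun u' : U => (S u', u')) u he hg).unique
      ((hasFDerivAt_const (0 : Z →L[ℝ] ℝ) u).congr_of_eventuallyEq hstate)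
  refine ⟨J' ∘L S'.prod (ContinuousLinearMap.id ℝ U),
    HasFDerivAt.comp (f := fun u' : U => (S u', u')) u hJ hg, fun h => ?_⟩
  have hsplit : (S' h, h) = (S' h, (0 : U)) + ((0 : Y), h) := by simp
  have hlin : (e' (S' h, h)) p = 0 := congrArg (fun A => (A h) p) hzero
  have hsum : (e' (S' h, 0)) p + (e' (0, h)) p = 0 := by
    rwa [hsplit, map_add, add_apply] at hlin
  change J' (S' h, h) = _
  rw [hsplit, map_add]
  linarith [hadj (S' h)]
end

section
/- Let U be a real Hilbert space, Y and Z real Banach spaces, let J : Y × U → ℝ be a cost functional and e : Y × U → Z* a state operator, both Fréchet differentiable at the point (S(u), u), and let S : U → Y be a solution map for the state equation satisfying e(S(u'), u') = 0 for all u' in a neighborhood of u and Fréchet differentiable at u. Define the reduced cost functional Ĵ(u) = J(S(u), u), and suppose p ∈ Z satisfies the adjoint equation: for all v ∈ Y, (e_y(S(u), u)[v])(p) = − J_y(S(u), u)[v]. Then there exists a unique g ∈ U such that ⟨g, h⟩_U = J_u(S(u), u)[h] + (e_u(S(u), u)[h])(p) for all h ∈ U, and this g is the gradient of the reduced cost functional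 at u, i.e. Ĵ'(u)[h] = ⟨g, h⟩_U for every h ∈ U. -/
open scoped RealInnerProductSpace

/-- A map that vanishes along the graph of `S` near `u` has derivative zero along the tangent of
that graph. -/
theorem HasFDerivAt.apply_tangent_eq_zero {𝕜 U Y W : Type*} [NontriviallyNormedField 𝕜]
    [NormedAddCommGroup U] [NormedSpace 𝕜 U] [NormedAddCommGroup Y] [NormedSpace 𝕜 Y]
    [NormedAddCommGroup W] [NormedSpace 𝕜 W]
    {e : Y × U → W} {S : U → Y} {u : U} {e' : Y × U →L[𝕜] W} {S' : U →L[𝕜] Y}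
    (he : HasFDerivAt e e' (S u, u)) (hS : HasFDerivAt S S' u)
    (hstate : ∀ᶠ u' in nhds u, e (S u', u') = 0) (h : U) : e' (S' h, h) = 0 := by
  have hcomp : HasFDerivAt (fun u' => e (S u', u'))
      (e'.comp (S'.prod (ContinuousLinearMap.id 𝕜 U))) u :=
    HasFDerivAt.comp (f := fun u' => (S u', u')) u he (hS.prodMk (hasFDerivAt_id u))
  have hzero : HasFDerivAt (fun u' => e (S u', u')) (0 : U →L[𝕜] W) u :=
    (hasFDerivAt_const (0 : W) u).congr_of_eventuallyEq hstate
  simpa using DFunLike.congr_fun (hcomp.unique hzero) h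

/-- Let `U` be a real Hilbert space. If `J` and `e` are Fréchet differentiable at `(S u, u)`,
the solution map `S` is Fréchet differentiable at `u` and satisfies `e(S u', u') = 0` near
`u`, and `p ∈ Z` solves the adjoint equation, then there is a unique `g ∈ U` with
`⟪g, h⟫ = J_u(S u, u)[h] + (e_u(S u, u)[h])(p)` for all `h`, and this `g` is the gradient of
the reduced cost functional at `u`, i.e. `Ĵ'(u)[h] = ⟪g, h⟫` for all `h`. -/
theorem gradient_of_reduced_cost_functional
    {U Y Z : Type*}
    [NormedAddCommGroup U] [InnerProductSpace ℝ U] [CompleteSpace U]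
    [NormedAddCommGroup Y] [NormedSpace ℝ Y] [CompleteSpace Y]
    [NormedAddCommGroup Z] [NormedSpace ℝ Z] [CompleteSpace Z]
    (J : Y × U → ℝ) (e : Y × U → (Z →L[ℝ] ℝ))
    (S : U → Y) (u : U)
    (J' : Y × U →L[ℝ] ℝ) (hJ : HasFDerivAt J J' (S u, u))
    (e' : Y × U →L[ℝ] (Z →L[ℝ] ℝ)) (he : HasFDerivAt e e' (S u, u))
    (S' : U →L[ℝ] Y) (hS' : HasFDerivAt S S' u)
    (hstate : ∀ᶠ u' in nhds u, e (S u', u') = 0)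
    (p : Z) (hadj : ∀ v : Y, (e' (v, 0)) p = - J' (v, 0)) :
    ∃! g : U,
      (∀ h : U, ⟪g, h⟫ = J' (0, h) + (e' (0, h)) p) ∧
      ∃ D : U →L[ℝ] ℝ, HasFDerivAt (fun u' : U => J (S u', u')) D u ∧
        ∀ h : U, D h = ⟪g, h⟫ := by
  have hJS : HasFDerivAt (fun u' => J (S u', u'))
      (J'.comp (S'.prod (ContinuousLinearMap.id ℝ U))) u :=
    HasFDerivAt.comp (f := fun u' => (S u', u')) u hJ (hS'.prodMk (hasFDerivAt_id u))
  set D := J'.comp (S'.prod (ContinuousLinearMap.id ℝ U))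
  have hD (h : U) : D h = J' (0, h) + (e' (0, h)) p := by
    have hsplit : ((S' h, h) : Y × U) = (S' h, 0) + (0, h) := by simp
    have hlin := congrArg (fun φ : Z →L[ℝ] ℝ => φ p) (he.apply_tangent_eq_zero hS' hstate h)
    rw [hsplit, map_add] at hlin
    simp only [add_apply, hadj, zero_apply] at hlin
    have hDh : D h = J' (S' h, 0) + J' (0, h) := by
      rw [← map_add, ← hsplit]
      rfl
    linarith
  have hg (h : U) : ⟪(InnerProductSpace.toDual ℝ U).symm D, h⟫ = D h :=
    InnerProductSpace.toDual_symm_apply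
  refine ⟨(InnerProductSpace.toDual ℝ U).symm D,
    ⟨fun h => (hg h).trans (hD h), D, hJS, fun h => (hg h).symm⟩, ?_⟩
  rintro g ⟨hg', -⟩
  exact ext_inner_right ℝ fun h => by rw [hg', hg, hD]
end
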